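/- Let D be the division algebra part of a simple component of FG for a finite group G and abelian number field F. Then for every finite rational prime p not dividing |G|, the local index of D at every prime of its center lying over p is 1. -/

import Mathlib

open scoped TensorProduct

/-- `A` is the cyclic algebra `(L/K, σ, a)`. -/
def IsCyclicAlgebra (K : Type*) [Field K] (L : Type*) [Field L] [Algebra K L]
    (σ : L ≃ₐ[K] L) (a : L) (A : Type*) [Ring A] [Algebra K A] : Prop :=
  ∃ (ι : L →ₐ[K] A) (u : Aˣ),
    (u : A) ^ Module.finrank K L = ι a ∧
    (∀ x : L, (u : A) * ι x = ι (σ x) * (u : A)) ∧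
    Function.Bijective fun f : Fin (Module.finrank K L) → L =>
      ∑ i, ι (f i) * (u : A) ^ (i : ℕ)

/-- The Schur index of a central simple `K`-algebra. -/
noncomputable def schurIndex (K A : Type*) [Field K] [Ring A] [Algebra K A] : ℕ :=
  sInf {m | ∃ (D : Type) (_ : DivisionRing D) (_ : Algebra K D) (r : ℕ),
      Nonempty (A ≃ₐ[K] Matrix (Fin r) (Fin r) D) ∧ m * m = Module.finrank K D}

/-- Local index at a real embedding. -/
noncomputable def realLocalIndex (K A : Type*) [Field K] [Ring A] [Algebra K A]
    (φ : K →+* ℝ) : ℕ :=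
  letI := φ.toAlgebra
  schurIndex ℝ (ℝ ⊗[K] A)

def IsBrauerEquiv (K A B : Type*) [Field K] [Ring A] [Algebra K A] [Ring B] [Algebra K B] :
    Prop :=
  ∃ r s : ℕ, 0 < r ∧ 0 < s ∧
    Nonempty (Matrix (Fin r) (Fin r) A ≃ₐ[K] Matrix (Fin s) (Fin s) B)

/-- The simple component `Re` of `R`, realized as `R/(1-e)`. -/
abbrev simpleComponent (R : Type*) [Ring R] (e : R) : Type _ :=
  (TwoSidedIdeal.span {1 - e}).ringCon.Quotient

noncomputable instance (F R : Type*) [CommSemiring F] [Ring R] [Algebra F R] (e : R) :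
    Algebra F (simpleComponent R e) :=
  RingHom.toAlgebra' ((TwoSidedIdeal.span {1 - e}).ringCon.mk'.comp (algebraMap F R)) <| by
    intro c x
    induction x using Quotient.inductionOn' with
    | h x =>
        show ((algebraMap F R c : R) : simpleComponent R e) * (x : simpleComponent R e)
          = (x : simpleComponent R e) * ((algebraMap F R c : R) : simpleComponent R e)
        rw [← RingCon.coe_mul, ← RingCon.coe_mul, Algebra.commutes]

/-- `e` is a centrally primitive idempotent. -/
def IsCentrallyPrimitiveIdempotent (R : Type*) [Ring R] (e : R) : Prop :=
  e ∈ Subring.center R ∧ e * e = e ∧ e ≠ 0 ∧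
    ∀ a b : R, a ∈ Subring.center R → b ∈ Subring.center R → a * a = a → b * b = b →
      a * b = 0 → e = a + b → a = 0 ∨ b = 0




noncomputable instance (priority := 1000) adicSMulCommClass {R : Type*} [CommRing R]
    [IsDedekindDomain R] {K : Type*} [Field K] [Algebra R K] [IsFractionRing R K]
    (v : IsDedekindDomain.HeightOneSpectrum R) :
    SMulCommClass K (v.adicCompletion K) (v.adicCompletion K) :=
  Algebra.to_smulCommClass

section TensorProduct

variable {Z K D : Type*} [Field Z] [Field K] [Algebra Z K] [DivisionRing D] [Algebra Z D]

theorem equivFinsuppOfBasisLeft_one_tmul_mul {ι : Type*} [DecidableEq ι]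
    (b : Module.Basis ι Z K) (d : D) (x : K ⊗[Z] D) (i : ι) :
    TensorProduct.equivFinsuppOfBasisLeft b ((1 ⊗ₜ d) * x) i =
      d * TensorProduct.equivFinsuppOfBasisLeft b x i := by
  induction x with
  | zero => simp
  | tmul k d' => simp
  | add x y hx hy => simp [mul_add, hx, hy]

theorem equivFinsuppOfBasisLeft_mul_one_tmul {ι : Type*} [DecidableEq ι]
    (b : Module.Basis ι Z K) (d : D) (x : K ⊗[Z] D) (i : ι) :
    TensorProduct.equivFinsuppOfBasisLeft b (x * (1 ⊗ₜ d)) i =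
      TensorProduct.equivFinsuppOfBasisLeft b x i * d := by
  induction x with
  | zero => simp
  | tmul k d' => simp
  | add x y hx hy => simp [add_mul, hx, hy]

theorem exists_eq_tmul_one_of_commute
    (hZ : Set.range (algebraMap Z D) = (Subring.center D : Set D)) (x : K ⊗[Z] D)
    (hx : ∀ d : D, (1 ⊗ₜ d) * x = x * (1 ⊗ₜ d)) : ∃ k : K, x = k ⊗ₜ 1 := by
  classical
  let b := Module.Basis.ofVectorSpace Z K
  let E := TensorProduct.equivFinsuppOfBasisLeft (N := D) b
  have hinj : Function.Injective (algebraMap Z D) := (algebraMap Z D).injective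
  have hmem : ∀ i, ∃ z, algebraMap Z D z = E x i := by
    intro i
    have : E x i ∈ (Subring.center D : Set D) := by
      rw [SetLike.mem_coe, Subring.mem_center_iff]
      intro d
      rw [← equivFinsuppOfBasisLeft_one_tmul_mul, hx d, equivFinsuppOfBasisLeft_mul_one_tmul]
    rwa [← hZ] at this
  have hg0 : Function.invFun (algebraMap Z D) 0 = 0 := by
    rw [← map_zero (algebraMap Z D)]
    exact Function.leftInverse_invFun hinj 0
  refine ⟨b.repr.symm ((E x).mapRange (Function.invFun (algebraMap Z D)) hg0), ?_⟩
  apply E.injective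
  ext i
  obtain ⟨z, hz⟩ := hmem i
  simp only [E, TensorProduct.equivFinsuppOfBasisLeft_apply_tmul_apply] at hz ⊢
  rw [LinearEquiv.apply_symm_apply, Finsupp.mapRange_apply, ← hz,
    Function.leftInverse_invFun hinj, Algebra.algebraMap_eq_smul_one]

theorem one_mem_of_ne_zero_mem
    (hZ : Set.range (algebraMap Z D) = (Subring.center D : Set D))
    (I : TwoSidedIdeal (K ⊗[Z] D)) {x : K ⊗[Z] D} (hx : x ∈ I) (hx0 : x ≠ 0) : 1 ∈ I := by
  classical
  let b := Module.Basis.ofVectorSpace Z K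
  let E := TensorProduct.equivFinsuppOfBasisLeft (N := D) b
  induction hn : (E x).support.card using Nat.strong_induction_on generalizing x with
  | _ n ih =>
    obtain ⟨i, hi⟩ : ∃ i, E x i ≠ 0 := by
      by_contra! h
      exact hx0 (E.injective (by ext i; simp [h i]))
    set y := x * (1 ⊗ₜ (E x i)⁻¹) with hy
    have hyI : y ∈ I := I.mul_mem_right _ _ hx
    have hyE : ∀ j, E y j = E x j * (E x i)⁻¹ := fun j ↦
      equivFinsuppOfBasisLeft_mul_one_tmul b _ x j
    by_cases hcomm : ∀ d : D, (1 ⊗ₜ d) * y = y * (1 ⊗ₜ d)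
    · obtain ⟨k, hk⟩ := exists_eq_tmul_one_of_commute hZ y hcomm
      have hk0 : k ≠ 0 := by
        rintro rfl
        have := hyE i
        rw [hk, mul_inv_cancel₀ hi] at this
        simp at this
      have : (k⁻¹ ⊗ₜ 1) * y = (1 : K ⊗[Z] D) := by
        rw [hk, Algebra.TensorProduct.tmul_mul_tmul, inv_mul_cancel₀ hk0, one_mul,
          Algebra.TensorProduct.one_def]
      exact this ▸ I.mul_mem_left _ _ hyI
    · push Not at hcomm
      obtain ⟨d, hd⟩ := hcomm
      have hwE : ∀ j, E ((1 ⊗ₜ d) * y - y * (1 ⊗ₜ d)) j = d * E y j - E y j * d := by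
        intro j
        rw [map_sub, Finsupp.sub_apply]
        exact congrArg₂ _ (equivFinsuppOfBasisLeft_one_tmul_mul b d y j)
          (equivFinsuppOfBasisLeft_mul_one_tmul b d y j)
      refine ih _ ?_ (I.sub_mem (I.mul_mem_left _ _ hyI) (I.mul_mem_right _ _ hyI))
        (sub_ne_zero.2 hd) rfl
      rw [← hn]
      apply Finset.card_lt_card
      refine Finset.ssubset_iff_of_subset (fun j hj ↦ ?_) |>.2 ⟨i, ?_, ?_⟩
      · rw [Finsupp.mem_support_iff] at hj ⊢
        intro h
        exact hj (by rw [hwE, hyE, h]; simp)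
      · simpa using hi
      · rw [Finsupp.notMem_support_iff, hwE, hyE, mul_inv_cancel₀ hi]; simp

theorem isSimpleRing_tensorProduct
    (hZ : Set.range (algebraMap Z D) = (Subring.center D : Set D)) :
    IsSimpleRing (K ⊗[Z] D) where
  simple :=
    { eq_bot_or_eq_top I := by
        by_cases h : ∃ x ∈ I, x ≠ 0
        · obtain ⟨x, hx, hx0⟩ := h
          exact .inr (I.one_mem_iff.1 (one_mem_of_ne_zero_mem hZ I hx hx0))
        · push Not at h
          exact .inl (le_bot_iff.1 fun x hx ↦ (TwoSidedIdeal.mem_bot _).2 (h x hx)) }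

end TensorProduct

theorem Matrix.mul_comm_of_corner_commute {n D : Type*} [Fintype n] [DecidableEq n]
    [DivisionRing D] {e : Matrix n n D} (he : e ≠ 0) (hee : e * e = e)
    (h : ∀ x y : Matrix n n D, Commute (e * x * e) (e * y * e)) (a b : D) : a * b = b * a := by
  obtain ⟨i, j, hij⟩ : ∃ i j, e i j ≠ 0 := by
    by_contra! h0
    exact he (by ext i j; exact h0 i j)
  set c := e i j
  have key : ∀ x y : D, c * x * c * y * c = c * y * c * x * c := by
    have entry : ∀ x y : D,
        (e * single j i x * e * (e * single j i y * e)) i j = c * x * c * y * c := by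
      intro x y
      have : e * single j i x * e * (e * single j i y * e) =
          e * (single j i x * e * single j i y) * e := by
        simp only [mul_assoc]; rw [← mul_assoc e e, hee]
      rw [this, single_mul_mul_single, mul_assoc, Matrix.mul_apply, Finset.sum_eq_single j]
      · rw [single_mul_apply_same]; simp only [c, mul_assoc]
      · intro k _ hk
        rw [single_mul_apply_of_ne _ _ _ _ _ hk, mul_zero]
      · simp
    intro x y
    rw [← entry, (h _ _).eq, entry]
  have key' : ∀ x y : D, x * c * y = y * c * x := by
    intro x y
    have := key x y
    simp only [mul_assoc] at this
    have := mul_left_cancel₀ hij this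
    simp only [← mul_assoc] at this
    exact mul_right_cancel₀ hij this
  have hc : ∀ x, c * x = x * c := fun x ↦ by simpa using (key' 1 x)
  have := key' a b
  rw [mul_assoc, hc b, mul_assoc b, hc a, ← mul_assoc, ← mul_assoc] at this
  exact mul_right_cancel₀ hij this

theorem IsSemisimpleRing.exists_idempotents_corner_powers (A : Type*) [Ring A] [Finite A]
    [IsSemisimpleRing A] :
    ∃ (ι : Type) (_ : Fintype ι) (e : ι → A), (∀ i, e i * e i = e i) ∧ ∑ i, e i = 1 ∧
      ∀ i, ∃ θ, e i * θ * e i = θ ∧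
        ∀ x, e i * x * e i = 0 ∨ ∃ n : ℕ, e i * x * e i = e i * θ ^ n := by
  classical
  obtain ⟨n, D, d, _, ⟨E⟩⟩ := isSemisimpleRing_iff_pi_matrix_divisionRing.1 ‹IsSemisimpleRing A›
  let S (i : Fin n) (j : Fin (d i)) (a : D i) : ∀ i, Matrix (Fin (d i)) (Fin (d i)) (D i) :=
    Pi.single i (Matrix.single j j a)
  have S_mul (i : Fin n) (j : Fin (d i)) (a b : D i) : S i j a * S i j b = S i j (a * b) := by
    simp only [S]
    rw [← Pi.single_mul, Matrix.single_mul_single_same]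
  have S_corner (i : Fin n) (j : Fin (d i)) (x) :
      S i j 1 * x * S i j 1 = S i j (x i j j) := by
    ext k : 1
    obtain rfl | hk := eq_or_ne k i
    · simp only [S, Pi.mul_apply, Pi.single_eq_same]
      rw [Matrix.single_mul_mul_single, one_mul, mul_one]
    · simp only [S, Pi.mul_apply, Pi.single_eq_of_ne hk, mul_zero]
  have S_pow (i : Fin n) (j : Fin (d i)) (a : D i) (m : ℕ) :
      S i j 1 * S i j a ^ m = S i j (a ^ m) := by
    induction m with
    | zero => simp
    | succ m ih => rw [pow_succ, ← mul_assoc, ih, S_mul, pow_succ]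
  refine ⟨Σ i, Fin (d i), inferInstance, fun ij ↦ E.symm (S ij.1 ij.2 1), ?_, ?_, ?_⟩
  · rintro ⟨i, j⟩
    rw [← map_mul, S_mul, one_mul]
  · rw [← map_sum, ← map_one E.symm, Fintype.sum_sigma]
    congr 1
    ext i : 1
    simp only [S, Finset.sum_apply]
    rw [Finset.sum_eq_single i]
    · simp only [Pi.single_eq_same]
      rw [Pi.one_apply, Matrix.sum_single_one]
    · intro k _ hk
      simp [Pi.single_eq_of_ne hk.symm]
    · simp
  · rintro ⟨i, j⟩
    have : Finite (D i) := by
      refine Finite.of_surjective (fun a : A ↦ E a i j j) fun y ↦ ⟨E.symm (S i j y), ?_⟩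
      simp [S]
    let := littleWedderburn (D i)
    obtain ⟨u, hu⟩ := IsCyclic.exists_generator (α := (D i)ˣ)
    refine ⟨E.symm (S i j u), ?_, fun x ↦ ?_⟩
    · rw [← map_mul, ← map_mul, S_mul, S_mul, one_mul, mul_one]
    · have hx : E.symm (S i j 1) * x * E.symm (S i j 1) = E.symm (S i j (E x i j j)) := by
        rw [← S_corner, map_mul, map_mul, E.symm_apply_apply]
      simp only [hx]
      by_cases h0 : E x i j j = 0
      · left
        simp [h0, S]
      · right
        obtain ⟨m, hm⟩ := (mem_powers_iff_mem_zpowers).2 (hu (Units.mk0 _ h0))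
        refine ⟨m, ?_⟩
        rw [← map_pow, ← map_mul, S_pow]
        have := congrArg Units.val hm
        simp only [Units.val_pow_eq_pow_val, Units.val_mk0] at this
        rw [this]

section Order

open IsLocalRing

variable {O G : Type*} [CommRing O] [IsLocalRing O] [Group G]

theorem MonoidAlgebra.exists_idempotent_lift [Finite G] [TopologicalSpace O] [IsTopologicalRing O]
    [CompactSpace O] [T2Space O] (hm : IsClosed (maximalIdeal O : Set O))
    (e : MonoidAlgebra (ResidueField O) G) (he : e * e = e) :
    ∃ f : MonoidAlgebra O G, f * f = f ∧ mapRingHom G (residue O) f = e := by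
  classical
  have := Fintype.ofFinite G
  let E : MonoidAlgebra O G ≃ (G → O) := coeffEquiv.trans Finsupp.equivFunOnFinite
  let : TopologicalSpace (MonoidAlgebra O G) := .induced E inferInstance
  let H : MonoidAlgebra O G ≃ₜ (G → O) := E.toHomeomorphOfIsInducing ⟨rfl⟩
  have : CompactSpace (MonoidAlgebra O G) := H.symm.compactSpace
  have : T2Space (MonoidAlgebra O G) := H.symm.t2Space
  have hcoeff (g : G) : Continuous fun x : MonoidAlgebra O G ↦ x.coeff g :=
    (continuous_apply g).comp H.continuous
  have hmul (r : MonoidAlgebra O G) : Continuous (· * r) := by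
    refine continuous_induced_rng.2 (continuous_pi fun g ↦ ?_)
    have : (fun x ↦ E (x * r) g) = fun x : MonoidAlgebra O G ↦
        ∑ p : G × G with p.1 * p.2 = g, x.coeff p.1 * r.coeff p.2 := by
      ext x
      exact coeff_mul_antidiag x r g _ (by simp)
    change Continuous fun x ↦ E (x * r) g
    rw [this]
    exact continuous_finsetSum _ fun p _ ↦ (hcoeff p.1).mul continuous_const
  have hclosed : IsClosed {f : MonoidAlgebra O G | mapRingHom G (residue O) f = e} := by
    have hres (c : ResidueField O) : IsClosed (residue O ⁻¹' {c}) := by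
      obtain ⟨a, rfl⟩ := residue_surjective c
      have : residue O ⁻¹' {residue O a} = (fun x ↦ x - a) ⁻¹' (maximalIdeal O : Set O) := by
        ext x
        rw [Set.mem_preimage, Set.mem_preimage, SetLike.mem_coe, ← residue_eq_zero_iff, map_sub,
          sub_eq_zero, Set.mem_singleton_iff]
      rw [this]
      exact hm.preimage (continuous_id.sub continuous_const)
    have : {f : MonoidAlgebra O G | mapRingHom G (residue O) f = e} =
        ⋂ g, (fun f : MonoidAlgebra O G ↦ f.coeff g) ⁻¹' (residue O ⁻¹' {e.coeff g}) := by
      ext f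
      simp [MonoidAlgebra.ext_iff, Finsupp.ext_iff]
    rw [this]
    exact isClosed_iInter fun g ↦ (hres _).preimage (hcoeff g)
  have hne : {f : MonoidAlgebra O G | mapRingHom G (residue O) f = e}.Nonempty :=
    MonoidAlgebra.map_surjective (residue O).toAddMonoidHom residue_surjective e
  obtain ⟨f, hf, hff⟩ := exists_idempotent_in_compact_subsemigroup hmul _ hne hclosed.isCompact
    fun x hx y hy ↦ by
      simp only [Set.mem_ofPred_eq] at hx hy ⊢
      rw [map_mul, hx, hy, he]
  exact ⟨f, hff, hf⟩

theorem MonoidAlgebra.mem_smul_top_of_mapRingHom_residue_eq_zero {x : MonoidAlgebra O G}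
    (hx : mapRingHom G (residue O) x = 0) :
    x ∈ maximalIdeal O • (⊤ : Submodule O (MonoidAlgebra O G)) := by
  have hsum : x = x.coeff.sum fun g r ↦ r • single g 1 := by
    conv_lhs => rw [← sum_coeff_single x]
    simp
  rw [hsum]
  refine Submodule.sum_mem _ fun g _ ↦ Submodule.smul_mem_smul ?_ trivial
  rw [← residue_eq_zero_iff, ← coeff_mapRingHom, hx]
  rfl

theorem MonoidAlgebra.corner_commute_of_residue_corner_powers [Finite G] {f : MonoidAlgebra O G}
    (hf : f * f = f) {θ : MonoidAlgebra (ResidueField O) G}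
    (hθ : mapRingHom G (residue O) f * θ * mapRingHom G (residue O) f = θ)
    (h : ∀ x, mapRingHom G (residue O) f * x * mapRingHom G (residue O) f = 0 ∨
      ∃ n : ℕ, mapRingHom G (residue O) f * x * mapRingHom G (residue O) f =
        mapRingHom G (residue O) f * θ ^ n)
    (x y : MonoidAlgebra O G) : Commute (f * x * f) (f * y * f) := by
  set π := mapRingHom G (residue O)
  obtain ⟨t, rfl⟩ : ∃ t, π t = θ :=
    MonoidAlgebra.map_surjective (residue O).toAddMonoidHom residue_surjective θ
  set s := f * t * f with hs
  have hπs : π s = π t := by rw [hs, map_mul, map_mul, hθ]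
  have hfs : f * s = s := by rw [hs, ← mul_assoc, ← mul_assoc, hf]
  have hsf : s * f = s := by rw [hs, mul_assoc, hf]
  have hcomm : Commute f s := by rw [Commute, SemiconjBy, hfs, hsf]
  let L : MonoidAlgebra O G →ₗ[O] MonoidAlgebra O G :=
    (LinearMap.mulRight O f) ∘ₗ (LinearMap.mulLeft O f)
  have hL (z) : L z = f * z * f := rfl
  let N' : Submodule O (MonoidAlgebra O G) := Submodule.span O (Set.range fun n : ℕ ↦ f * s ^ n)
  have hLpow (n : ℕ) : L (f * s ^ n) = f * s ^ n := by
    rw [hL, ← mul_assoc, hf, mul_assoc, ← (hcomm.pow_right n).eq, ← mul_assoc, hf]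
  have hker (z) (hz : π (L z) = 0) (hLz : L (L z) = L z) :
      L z ∈ maximalIdeal O • LinearMap.range L := by
    have := Submodule.mem_map_of_mem (f := L) (mem_smul_top_of_mapRingHom_residue_eq_zero hz)
    rwa [Submodule.map_smul'', Submodule.map_top, hLz] at this
  have hLL (z) : L (L z) = L z := by
    simp only [hL, mul_assoc, hf]
    rw [← mul_assoc f f, hf]
  have hle : LinearMap.range L ≤ N' := by
    refine Submodule.le_of_le_smul_of_le_jacobson_bot (I := maximalIdeal O) ?_
      (maximalIdeal_le_jacobson _) ?_
    · rw [LinearMap.range_eq_map]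
      exact Module.Finite.fg_top.map L
    · rintro _ ⟨z, rfl⟩
      have hπL : π (L z) = π f * π z * π f := by rw [hL, map_mul, map_mul]
      obtain h0 | ⟨n, hn⟩ := h (π z)
      · exact Submodule.mem_sup_right (hker z (hπL.trans h0) (hLL z))
      · have hz : L z = f * s ^ n + L (z - f * s ^ n) := by rw [map_sub, hLpow]; abel
        rw [hz]
        refine Submodule.add_mem_sup (Submodule.subset_span ⟨n, rfl⟩) (hker _ ?_ (hLL _))
        rw [map_sub, map_sub, hLpow, hπL, hn, map_mul, map_pow, hπs, sub_self]
  have hN'comm : ∀ a ∈ N', ∀ b ∈ N', Commute a b := by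
    intro a ha b hb
    induction ha, hb using Submodule.span_induction₂ with
    | mem_mem a b ha hb =>
      obtain ⟨m, rfl⟩ := ha
      obtain ⟨n, rfl⟩ := hb
      exact ((Commute.refl f).mul_left (hcomm.symm.pow_left m)).mul_right
        ((hcomm.pow_right n).mul_left ((Commute.refl s).pow_pow m n))
    | zero_left b hb => exact .zero_left b
    | zero_right a ha => exact .zero_right a
    | add_left a b c _ _ _ h₁ h₂ => exact h₁.add_left h₂
    | add_right a b c _ _ _ h₁ h₂ => exact h₁.add_right h₂
    | smul_left r a b _ _ h₁ => exact h₁.smul_left r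
    | smul_right r a b _ _ h₁ => exact h₁.smul_right r
  exact hN'comm _ (hle ⟨x, rfl⟩) _ (hle ⟨y, rfl⟩)

theorem MonoidAlgebra.exists_idempotent_corner_commute [Finite G] [TopologicalSpace O]
    [IsTopologicalRing O] [CompactSpace O] [T2Space O] (hm : IsClosed (maximalIdeal O : Set O))
    [Finite (ResidueField O)] (hG : (Nat.card G : ResidueField O) ≠ 0)
    {B : Type*} [Ring B] [Nontrivial B] (ψ : MonoidAlgebra O G →+* B) :
    ∃ f : MonoidAlgebra O G, f * f = f ∧ ψ f ≠ 0 ∧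
      ∀ x y, Commute (f * x * f) (f * y * f) := by
  have : NeZero (Nat.card G : ResidueField O) := ⟨hG⟩
  have : Finite (MonoidAlgebra (ResidueField O) G) :=
    .of_equiv _ (coeffEquiv.trans Finsupp.equivFunOnFinite).symm
  have : IsSemisimpleRing (MonoidAlgebra (ResidueField O) G) :=
    inferInstanceAs (IsSemisimpleModule _ (MonoidAlgebra (ResidueField O) G))
  obtain ⟨ι, _, e, he, hsum, hθ⟩ :=
    IsSemisimpleRing.exists_idempotents_corner_powers (MonoidAlgebra (ResidueField O) G)
  choose f hff hfe using fun i ↦ exists_idempotent_lift hm (e i) (he i)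
  obtain ⟨i, hi⟩ : ∃ i, ψ (f i) ≠ 0 := by
    by_contra! h0
    have hle : ⊤ ≤ LinearMap.range (LinearMap.mulLeft O (∑ i, f i)) := by
      refine Submodule.le_of_le_smul_of_le_jacobson_bot (I := maximalIdeal O)
        Module.Finite.fg_top (maximalIdeal_le_jacobson _) fun y _ ↦ ?_
      rw [show y = (∑ i, f i) * y + (y - (∑ i, f i) * y) by abel]
      refine Submodule.add_mem_sup ⟨y, rfl⟩ (mem_smul_top_of_mapRingHom_residue_eq_zero ?_)
      rw [map_sub, map_mul, map_sum]
      simp [hfe, hsum]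
    obtain ⟨y, hy⟩ := hle (Submodule.mem_top (x := 1))
    have := congrArg ψ hy
    simp [h0] at this
  obtain ⟨θ, hθ, h⟩ := hθ i
  rw [← hfe i] at hθ h
  exact ⟨f i, hff i, hi, corner_commute_of_residue_corner_powers (hff i) hθ h⟩

end Order

section AdicCompletion

open IsDedekindDomain IsDedekindDomain.HeightOneSpectrum IsLocalRing

variable {R : Type*} [CommRing R] [IsDedekindDomain R] (K : Type*) [Field K] [Algebra R K]
  [IsFractionRing R K] (v : HeightOneSpectrum R)

theorem mem_maximalIdeal_adicCompletionIntegers_iff (x : v.adicCompletionIntegers K) :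
    x ∈ maximalIdeal (v.adicCompletionIntegers K) ↔
      Valued.v (x : v.adicCompletion K) < 1 :=
  Valuation.mem_maximalIdeal_iff (K := v.adicCompletion K) Valued.v

theorem isClosed_maximalIdeal_adicCompletionIntegers :
    IsClosed (maximalIdeal (v.adicCompletionIntegers K) : Set (v.adicCompletionIntegers K)) := by
  have := (Valued.isClosed_ball (v.adicCompletion K) 1).preimage
    (continuous_subtype_val (p := fun x ↦ x ∈ v.adicCompletionIntegers K))
  simp only [Valuation.restrict_lt_one_iff] at this
  convert this using 1
  ext x
  exact mem_maximalIdeal_adicCompletionIntegers_iff K v x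

theorem residue_algebraMap_adicCompletionIntegers_eq_zero_iff (a : R) :
    residue (v.adicCompletionIntegers K) (algebraMap R (v.adicCompletionIntegers K) a) = 0 ↔
      a ∈ v.asIdeal := by
  rw [residue_eq_zero_iff, mem_maximalIdeal_adicCompletionIntegers_iff,
    ← valuation_lt_one_iff_mem (K := K), ← valuedAdicCompletion_eq_valuation]
  rfl

theorem residue_comp_algebraMap_adicCompletionIntegers_surjective :
    Function.Surjective ((residue (v.adicCompletionIntegers K)).comp
      (algebraMap R (v.adicCompletionIntegers K))) := by
  intro c
  obtain ⟨x, rfl⟩ := residue_surjective c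
  have hopen : IsOpen {y : v.adicCompletion K | Valued.v (y - x) < 1} := by
    have := (Valued.isOpen_ball (v.adicCompletion K) 1).preimage
      (continuous_id.sub (continuous_const (y := (x : v.adicCompletion K))))
    simp only [Valuation.restrict_lt_one_iff] at this
    exact this
  obtain ⟨k, hk⟩ := (denseRange_algebraMap K v).exists_mem_open hopen ⟨x, by simp⟩
  have hk1 : v.valuation K k ≤ 1 := by
    rw [← valuedAdicCompletion_eq_valuation']
    have : (k : v.adicCompletion K) = (algebraMap K (v.adicCompletion K) k - x) + x :=
      (sub_add_cancel _ _).symm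
    rw [this]
    exact (Valuation.map_add _ _ _).trans (max_le (le_of_lt hk) x.2)
  obtain ⟨a, ha⟩ := v.exists_valuation_sub_lt_of_integer hk1 1
  rw [← valuedAdicCompletion_eq_valuation'] at ha
  refine ⟨a, ?_⟩
  rw [← sub_eq_zero, RingHom.comp_apply, ← map_sub, residue_eq_zero_iff,
    mem_maximalIdeal_adicCompletionIntegers_iff]
  have : ((algebraMap R (v.adicCompletionIntegers K) a - x : v.adicCompletionIntegers K) :
      v.adicCompletion K) = algebraMap K (v.adicCompletion K) (algebraMap R K a - k) +
        (algebraMap K (v.adicCompletion K) k - x) := by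
    rw [map_sub, sub_add_sub_cancel]
    rfl
  rw [this]
  exact (Valuation.map_add _ _ _).trans_lt (max_lt ha hk)

theorem finite_residueField_adicCompletionIntegers [Finite (R ⧸ v.asIdeal)] :
    Finite (ResidueField (v.adicCompletionIntegers K)) :=
  .of_surjective (Ideal.Quotient.lift v.asIdeal
      ((residue (v.adicCompletionIntegers K)).comp (algebraMap R (v.adicCompletionIntegers K)))
      fun a ↦ (residue_algebraMap_adicCompletionIntegers_eq_zero_iff K v a).2)
    (Ideal.Quotient.lift_surjective_of_surjective _ _
      (residue_comp_algebraMap_adicCompletionIntegers_surjective K v))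

theorem residueField_natCast_ne_zero {p : ℕ} (hp : p.Prime) (hv : (p : R) ∈ v.asIdeal) {n : ℕ}
    (hn : ¬p ∣ n) : (n : ResidueField (v.adicCompletionIntegers K)) ≠ 0 := by
  intro h
  have hn' : (n : R) ∈ v.asIdeal := by
    rw [← residue_algebraMap_adicCompletionIntegers_eq_zero_iff K v, map_natCast, map_natCast, h]
  have hcop := Nat.isCoprime_iff_coprime.2 ((hp.coprime_iff_not_dvd).2 hn)
  obtain ⟨a, b, hab⟩ := hcop.map (Int.castRingHom R)
  refine v.isPrime.ne_top ((Ideal.eq_top_iff_one _).2 (hab ▸ add_mem ?_ ?_))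
  · exact v.asIdeal.mul_mem_left _ (by simpa using hv)
  · exact v.asIdeal.mul_mem_left _ (by simpa using hn')

end AdicCompletion

section NumberField

open IsDedekindDomain NumberField

variable {Z : Type*} [Field Z] [NumberField Z] (v : HeightOneSpectrum (𝓞 Z))

theorem compactSpace_adicCompletionIntegers : CompactSpace (v.adicCompletionIntegers Z) := by
  have : Finite (𝓞 Z ⧸ v.asIdeal) := Ideal.finiteQuotientOfFreeOfNeBot v.asIdeal v.ne_bot
  have hclosed : IsClosed (Valued.integer (v.adicCompletion Z) : Set (v.adicCompletion Z)) :=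
    Valued.isClosed_integer _
  open Valued.integer in
  exact compactSpace_iff_completeSpace_and_isDiscreteValuationRing_and_finite_residueField.2
    ⟨hclosed.completeSpace_coe,
      inferInstanceAs (IsDiscreteValuationRing (v.adicCompletionIntegers Z)),
      finite_residueField_adicCompletionIntegers Z v⟩

end NumberField

section Splitting

variable {Z K D : Type*} [Field Z] [Field K] [Algebra Z K] [DivisionRing D] [Algebra Z D]

theorem exists_algEquiv_matrix_of_corner_commute [FiniteDimensional Z D]
    (hZ : Set.range (algebraMap Z D) = (Subring.center D : Set D)) {n : Type*} [Fintype n]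
    [DecidableEq n] {e : Matrix n n (K ⊗[Z] D)} (he : e ≠ 0) (hee : e * e = e)
    (h : ∀ x y, Commute (e * x * e) (e * y * e)) :
    ∃ s : ℕ, Nonempty (K ⊗[Z] D ≃ₐ[K] Matrix (Fin s) (Fin s) K) := by
  have := isSimpleRing_tensorProduct (K := K) hZ
  have : IsArtinianRing (K ⊗[Z] D) := IsArtinianRing.of_finite K _
  obtain ⟨s, hs, A, _, _, ⟨E⟩⟩ :=
    IsSimpleRing.exists_algEquiv_matrix_divisionRing K (K ⊗[Z] D)
  let Φ : Matrix n n (K ⊗[Z] D) ≃+* Matrix (n × Fin s) (n × Fin s) A :=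
    E.toRingEquiv.mapMatrix.trans (Matrix.compRingEquiv n (Fin s) A)
  have hA : ∀ a b : A, a * b = b * a := by
    refine Matrix.mul_comm_of_corner_commute (e := Φ e) ((map_ne_zero_iff Φ Φ.injective).2 he)
      (by rw [← map_mul, hee]) fun x y ↦ ?_
    obtain ⟨x, rfl⟩ := Φ.surjective x
    obtain ⟨y, rfl⟩ := Φ.surjective y
    simpa only [map_mul] using (h x y).map Φ
  have hsurj : Function.Surjective (algebraMap K A) := by
    intro a
    obtain ⟨k, hk⟩ := exists_eq_tmul_one_of_commute hZ (E.symm (Matrix.scalar (Fin s) a))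
      fun d ↦ E.injective (by
        rw [map_mul, map_mul, E.apply_symm_apply]
        exact (Matrix.scalar_commute a (fun b ↦ hA a b) _).symm)
    refine ⟨k, ?_⟩
    have h1 : E (k ⊗ₜ 1) = Matrix.scalar (Fin s) a := by rw [← hk, E.apply_symm_apply]
    have h2 : E (k ⊗ₜ 1) = algebraMap K _ k := E.commutes k
    rw [h2, Matrix.algebraMap_eq_diagonal] at h1
    simpa using congrFun (congrFun h1 0) 0
  let F : K ≃ₐ[K] A := AlgEquiv.ofBijective (Algebra.ofId K A)
    ⟨(algebraMap K A).injective, hsurj⟩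
  exact ⟨s, ⟨E.trans F.symm.mapMatrix⟩⟩

theorem MonoidAlgebra.exists_surjective_algHom_matrix_tensorProduct
    (hZ : Set.range (algebraMap Z D) = (Subring.center D : Set D)) {F G n : Type*} [CommRing F]
    [Group G] [Fintype n] [DecidableEq n] {φ : MonoidAlgebra F G →+* Matrix n n D}
    (hφ : Function.Surjective φ) :
    ∃ ψ : MonoidAlgebra K G →ₐ[K] Matrix n n (K ⊗[Z] D), Function.Surjective ψ := by
  let j : Matrix n n D →+* Matrix n n (K ⊗[Z] D) :=
    (Algebra.TensorProduct.includeRight : D →ₐ[Z] K ⊗[Z] D).toRingHom.mapMatrix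
  let ψ : MonoidAlgebra K G →ₐ[K] Matrix n n (K ⊗[Z] D) :=
    lift K _ G (((j.comp φ : _ →+* _) : _ →* _).comp (of F G))
  have hj (i k : n) (d : D) : j (Matrix.single i k d) = Matrix.single i k (1 ⊗ₜ d) :=
    Matrix.map_single i k d (Algebra.TensorProduct.includeRight : D →ₐ[Z] K ⊗[Z] D)
  have hscalar (c : F) : j (φ (algebraMap F _ c)) ∈ ψ.range := by
    have hc : φ (algebraMap F _ c) ∈ Subring.center (Matrix n n D) := by
      rw [Subring.mem_center_iff]
      intro M
      obtain ⟨x, rfl⟩ := hφ M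
      rw [← map_mul, ← map_mul, Algebra.commutes]
    rw [Matrix.subringCenter_eq_scalar_map] at hc
    obtain ⟨d, hd, hdc⟩ := hc
    obtain ⟨z, rfl⟩ := hZ.ge hd
    rw [← hdc]
    convert ψ.range.algebraMap_mem (algebraMap Z K z) using 1
    ext i k
    rcases eq_or_ne i k with rfl | hik
    · simp [j, Matrix.algebraMap_matrix_apply]
    · simp [j, Matrix.algebraMap_matrix_apply, hik]
  have hmem (M : Matrix n n D) : j M ∈ ψ.range := by
    obtain ⟨x, rfl⟩ := hφ M
    induction x using MonoidAlgebra.induction_on with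
    | of g => exact ⟨of K G g, by simp [ψ]⟩
    | add x y hx hy => rw [map_add, map_add]; exact add_mem hx hy
    | smul c x hx =>
      rw [Algebra.smul_def, map_mul, map_mul]
      exact mul_mem (hscalar c) hx
  refine ⟨ψ, fun M ↦ (?_ : M ∈ ψ.range)⟩
  rw [Matrix.matrix_eq_sum_single M]
  refine sum_mem fun i _ ↦ sum_mem fun k _ ↦ ?_
  induction M i k with
  | zero => simp
  | tmul c d =>
    have : Matrix.single i k (c ⊗ₜ[Z] d) = c • j (Matrix.single i k d) := by
      rw [hj, Matrix.smul_single, TensorProduct.smul_tmul', smul_eq_mul, mul_one]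
    rw [this]
    exact ψ.range.smul_mem (hmem _) c
  | add x y hx hy => rw [Matrix.single_add]; exact add_mem hx hy

theorem exists_algEquiv_matrix_of_surjective_monoidAlgebra [FiniteDimensional Z D]
    (hZ : Set.range (algebraMap Z D) = (Subring.center D : Set D)) {F G n : Type*} [CommRing F]
    [Group G] [Finite G] [Fintype n] [DecidableEq n] [Nonempty n]
    {φ : MonoidAlgebra F G →+* Matrix n n D} (hφ : Function.Surjective φ)
    {O : Type*} [CommRing O] [IsLocalRing O] [Algebra O K] [TopologicalSpace O]
    [IsTopologicalRing O] [CompactSpace O] [T2Space O]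
    (hm : IsClosed (IsLocalRing.maximalIdeal O : Set O)) [Finite (IsLocalRing.ResidueField O)]
    (hG : (Nat.card G : IsLocalRing.ResidueField O) ≠ 0) :
    ∃ s : ℕ, Nonempty (K ⊗[Z] D ≃ₐ[K] Matrix (Fin s) (Fin s) K) := by
  obtain ⟨ψ, hψ⟩ := MonoidAlgebra.exists_surjective_algHom_matrix_tensorProduct (K := K) hZ hφ
  let ι : MonoidAlgebra O G →+* MonoidAlgebra K G := MonoidAlgebra.mapRingHom G (algebraMap O K)
  obtain ⟨f, hf, hf0, hcomm⟩ := MonoidAlgebra.exists_idempotent_corner_commute hm hG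
    (ψ.toRingHom.comp ι)
  have hcomm' (x y : MonoidAlgebra K G) : Commute (ι f * x * ι f) (ι f * y * ι f) := by
    have hof (g : G) : MonoidAlgebra.of K G g = ι (MonoidAlgebra.of O G g) := by simp [ι]
    induction x using MonoidAlgebra.induction_on with
    | of g =>
      induction y using MonoidAlgebra.induction_on with
      | of g' => simpa only [hof, map_mul] using (hcomm _ _).map ι
      | add x y hx hy => rw [mul_add, add_mul]; exact hx.add_right hy
      | smul c x hx => rw [mul_smul_comm, smul_mul_assoc]; exact hx.smul_right c
    | add x y hx hy => rw [mul_add, add_mul]; exact hx.add_left hy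
    | smul c x hx => rw [mul_smul_comm, smul_mul_assoc]; exact hx.smul_left c
  refine exists_algEquiv_matrix_of_corner_commute hZ hf0 (by rw [← map_mul, hf]) fun x y ↦ ?_
  obtain ⟨x, rfl⟩ := hψ x
  obtain ⟨y, rfl⟩ := hψ y
  have := (hcomm' x y).map ψ
  simp only [map_mul] at this
  exact this

end Splitting

theorem schurIndex_eq_one_of_algEquiv_matrix {K : Type} [Field K] {A : Type*} [Ring A]
    [Nontrivial A] [Algebra K A] {s : ℕ} (E : A ≃ₐ[K] Matrix (Fin s) (Fin s) K) :
    schurIndex K A = 1 := by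
  have h1 : 1 ∈ {m | ∃ (D : Type) (_ : DivisionRing D) (_ : Algebra K D) (r : ℕ),
      Nonempty (A ≃ₐ[K] Matrix (Fin r) (Fin r) D) ∧ m * m = Module.finrank K D} :=
    ⟨K, inferInstance, Algebra.id K, s, ⟨E⟩, by simp⟩
  refine le_antisymm (Nat.sInf_le h1) (le_csInf ⟨1, h1⟩ ?_)
  rintro m ⟨D, _, _, r, ⟨E'⟩, hm⟩
  have hr : Nonempty (Fin r) := by
    by_contra hr
    rw [not_nonempty_iff] at hr
    exact not_subsingleton A E'.injective.subsingleton
  have i := hr.some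
  have := Module.Finite.equiv (E.symm.trans E').toLinearEquiv
  have : Module.Finite K D := .of_surjective (Matrix.entryLinearMap K D i i)
    fun d ↦ ⟨fun _ _ ↦ d, rfl⟩
  have hpos : 0 < Module.finrank K D := Module.finrank_pos
  rw [← hm] at hpos
  exact Nat.pos_of_mul_pos_left hpos

theorem nontrivial_simpleComponent {R : Type*} [Ring R] {e : R} (he : e ∈ Subring.center R)
    (hee : e * e = e) (he0 : e ≠ 0) : Nontrivial (simpleComponent R e) := by
  have hmul (x : R) (hx : x ∈ TwoSidedIdeal.span {1 - e}) : e * x = 0 := by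
    induction hx using TwoSidedIdeal.span_induction with
    | mem x hx => rw [Set.mem_singleton_iff.1 hx, mul_sub, mul_one, hee, sub_self]
    | zero => exact mul_zero e
    | add x y _ _ hx hy => rw [mul_add, hx, hy, add_zero]
    | neg x _ hx => rw [mul_neg, hx, neg_zero]
    | left_absorb a x _ hx =>
      rw [← mul_assoc, ← Subring.mem_center_iff.1 he a, mul_assoc, hx, mul_zero]
    | right_absorb b x _ hx => rw [← mul_assoc, hx, zero_mul]
  refine ⟨⟨1, 0, fun h ↦ he0 ?_⟩⟩
  have : (1 : R) ∈ TwoSidedIdeal.span {1 - e} :=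
    (TwoSidedIdeal.mem_iff _ _).2 ((RingCon.eq _).1 h)
  rw [← hmul 1 this, mul_one]

theorem schur_stmt9
    (F : Type) [Field F] [NumberField F] [IsGalois ℚ F]
    (hab : ∀ g h : F ≃ₐ[ℚ] F, g * h = h * g)
    (G : Type) [Group G] [Fintype G]
    (e : MonoidAlgebra F G) (he : IsCentrallyPrimitiveIdempotent (MonoidAlgebra F G) e)
    (D : Type) [DivisionRing D]
    (Z : Type) [Field Z] [NumberField Z] [Algebra Z D] [FiniteDimensional Z D]
    (hZ : Set.range (algebraMap Z D) = (Subring.center D : Set D))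
    (r : ℕ)
    (hD : Nonempty (simpleComponent (MonoidAlgebra F G) e ≃+* Matrix (Fin r) (Fin r) D))
    (p : ℕ) (hp : p.Prime) (hpG : ¬ p ∣ Fintype.card G)
    (v : IsDedekindDomain.HeightOneSpectrum (NumberField.RingOfIntegers Z))
    (hv : (p : NumberField.RingOfIntegers Z) ∈ v.asIdeal) :
    schurIndex (v.adicCompletion Z) ((v.adicCompletion Z) ⊗[Z] D) = 1 := by
  obtain ⟨φ⟩ := hD
  have := nontrivial_simpleComponent he.1 he.2.1 he.2.2.1
  have : Nonempty (Fin r) := by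
    by_contra hr
    rw [not_nonempty_iff] at hr
    exact not_subsingleton (simpleComponent (MonoidAlgebra F G) e) φ.injective.subsingleton
  have := compactSpace_adicCompletionIntegers v
  have : Finite (NumberField.RingOfIntegers Z ⧸ v.asIdeal) :=
    Ideal.finiteQuotientOfFreeOfNeBot v.asIdeal v.ne_bot
  have := finite_residueField_adicCompletionIntegers Z v
  have hφ : Function.Surjective
      (φ.toRingHom.comp (TwoSidedIdeal.span {1 - e}).ringCon.mk') :=
    φ.surjective.comp (RingCon.mk'_surjective _)
  obtain ⟨s, ⟨E⟩⟩ := exists_algEquiv_matrix_of_surjective_monoidAlgebra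
    (K := v.adicCompletion Z) hZ hφ (isClosed_maximalIdeal_adicCompletionIntegers Z v)
    (residueField_natCast_ne_zero Z v hp hv (Nat.card_eq_fintype_card (α := G) ▸ hpG))
  exact schurIndex_eq_one_of_algEquiv_matrix E
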